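/- (Lemma 3.1a, Mellin–Barnes form.) Let m, n be positive integers, let a > 0, z > 0 and v be real numbers, and let σ be a real number with σ > 0 and σ > −(v + 1). Then ∫₀^∞ exp(−a·y)·y^{v}·exp(−z·y^{−n/m}) dy = a^{−(v+1)}·(m/n)·(1/(2π))·∫_{−∞}^{∞} Γ((m/n)·(σ + iτ))·Γ(v + 1 + σ + iτ)·(a·z^{m/n})^{−(σ + iτ)} dτ. -/

import Mathlib

open Real MeasureTheory Complex

lemma gamma_norm_le {s : ℂ} (hs : 0 < s.re) : ‖Complex.Gamma s‖ ≤ Real.Gamma s.re := by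
  rw [Complex.Gamma_eq_integral hs, Real.Gamma_eq_integral hs, Complex.GammaIntegral]
  refine (norm_integral_le_integral_norm _).trans (le_of_eq ?_)
  refine setIntegral_congr_fun measurableSet_Ioi fun x hx => ?_
  simp only [norm_mul, Complex.norm_real, Real.norm_eq_abs, Real.abs_exp]
  rw [norm_cpow_eq_rpow_re_of_pos hx]
  simp

lemma gamma_vert_cont {c : ℝ} (hc : 0 < c) :
    Continuous fun τ : ℝ => Complex.Gamma ((c : ℂ) + τ * Complex.I) := by
  rw [continuous_iff_continuousAt]
  intro τ
  refine ContinuousAt.comp (g := Complex.Gamma) (f := fun τ : ℝ => (c : ℂ) + τ * Complex.I) ?_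
    (by fun_prop)
  refine (Complex.differentiableAt_Gamma _ fun k h => ?_).continuousAt
  have := congrArg Complex.re h
  simp at this
  have : (0:ℝ) ≤ k := Nat.cast_nonneg k
  linarith

lemma gamma_vert {c : ℝ} (hc : 0 < c) :
    Integrable fun τ : ℝ => Complex.Gamma ((c : ℂ) + τ * Complex.I) := by
  set k : ℝ := min 1 (c ^ 2) with hk
  have hkp : 0 < k := lt_min one_pos (by positivity)
  have h1 : k ≤ 1 := min_le_left _ _
  have h2 : k ≤ c ^ 2 := min_le_right _ _
  refine Integrable.mono' (integrable_inv_one_add_sq.const_mul (Real.Gamma (c + 2) / k))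
    (gamma_vert_cont hc).aestronglyMeasurable (Filter.Eventually.of_forall fun τ => ?_)
  set s : ℂ := (c : ℂ) + τ * Complex.I with hs
  have hre : s.re = c := by simp [hs]
  have him : s.im = τ := by simp [hs]
  have hs0 : s ≠ 0 := fun h => by rw [h] at hre; simp at hre; linarith
  have hs1 : s + 1 ≠ 0 := fun h => by
    have := congrArg Complex.re h
    simp [hre] at this; linarith
  have e : Complex.Gamma (s + 2) = (s + 1) * (s * Complex.Gamma s) := by
    rw [← Complex.Gamma_add_one s hs0, ← Complex.Gamma_add_one _ hs1]; congr 1; ring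
  have hb : ‖Complex.Gamma (s + 2)‖ ≤ Real.Gamma (c + 2) := by
    have := gamma_norm_le (s := s + 2) (by simp [hre]; linarith)
    simpa [hre] using this
  rw [e, norm_mul, norm_mul] at hb
  have hn : ‖s‖ ^ 2 = c ^ 2 + τ ^ 2 := by
    rw [← Complex.normSq_eq_norm_sq, Complex.normSq_apply, hre, him]; ring
  have hn1 : ‖s‖ ≤ ‖s + 1‖ := by
    refine (sq_le_sq₀ (norm_nonneg _) (norm_nonneg _)).1 ?_
    rw [← Complex.normSq_eq_norm_sq, ← Complex.normSq_eq_norm_sq, Complex.normSq_apply,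
      Complex.normSq_apply]
    simp [hre, him]; nlinarith
  have hq : k * (1 + τ ^ 2) ≤ ‖s + 1‖ * ‖s‖ := by
    calc k * (1 + τ ^ 2) ≤ c ^ 2 + τ ^ 2 := by nlinarith [sq_nonneg τ]
      _ = ‖s‖ * ‖s‖ := by rw [← hn]; ring
      _ ≤ _ := by gcongr
  have : Real.Gamma (c + 2) / k * (1 + τ ^ 2)⁻¹ = Real.Gamma (c + 2) / (k * (1 + τ ^ 2)) := by
    field_simp
  rw [this, le_div_iff₀ (by positivity)]
  calc ‖Complex.Gamma s‖ * (k * (1 + τ ^ 2)) ≤ ‖Complex.Gamma s‖ * (‖s + 1‖ * ‖s‖) := by gcongr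
    _ ≤ _ := by linarith

lemma exp_inv {c x : ℝ} (hc : 0 < c) (hx : 0 < x) :
    (Real.exp (-x) : ℂ) = (1 / (2 * (π : ℂ))) * ∫ τ : ℝ,
      (x : ℂ) ^ (-((c : ℂ) + τ * Complex.I)) * Complex.Gamma ((c : ℂ) + τ * Complex.I) := by
  have key : ∀ s : ℂ, 0 < s.re → mellin (fun x => (Real.exp (-x) : ℂ)) s = Complex.Gamma s := by
    intro s hs
    rw [← Complex.GammaIntegral_eq_mellin, Complex.Gamma_eq_integral hs]
  have h := mellinInv_mellin_eq c (fun x : ℝ => (Real.exp (-x) : ℂ)) hx ?_ ?_ (by fun_prop)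
  · rw [← h, mellinInv]
    have : ∀ τ : ℝ, mellin (fun x => (Real.exp (-x) : ℂ)) ((c : ℂ) + τ * Complex.I) =
      Complex.Gamma ((c : ℂ) + τ * Complex.I) := fun τ => key _ (by simpa using hc)
    simp_rw [this, smul_eq_mul, Complex.real_smul]
    push_cast; rfl
  · have := Complex.GammaIntegral_convergent (s := (c : ℂ)) (by simpa using hc)
    simpa only [MellinConvergent, smul_eq_mul, mul_comm] using this
  · refine (gamma_vert hc).congr (Filter.Eventually.of_forall fun τ => ?_)
    exact (key _ (by simpa using hc)).symm

lemma pos_cpow {x : ℝ} (hx : 0 < x) (s : ℂ) :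
    (x : ℂ) ^ s = Complex.exp ((Real.log x : ℂ) * s) := by
  rw [Complex.cpow_def_of_ne_zero (by exact_mod_cast hx.ne'), Complex.ofReal_log hx.le]

lemma exp_inv2 {r σ w : ℝ} (hr : 0 < r) (hσ : 0 < σ) (hw : 0 < w) :
    (Real.exp (-(w ^ (1 / r))) : ℂ) = r * (1 / (2 * (π : ℂ))) * ∫ τ : ℝ,
      Complex.Gamma (r * ((σ : ℂ) + τ * Complex.I)) * (w : ℂ) ^ (-((σ : ℂ) + τ * Complex.I)) := by
  rw [exp_inv (mul_pos hr hσ) (rpow_pos_of_pos hw (1 / r))]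
  have h := Measure.integral_comp_mul_left (fun τ : ℝ =>
    ((w ^ (1 / r) : ℝ) : ℂ) ^ (-(((r * σ : ℝ) : ℂ) + τ * Complex.I)) *
      Complex.Gamma (((r * σ : ℝ) : ℂ) + τ * Complex.I)) r
  have hr' : (r : ℂ) ≠ 0 := by exact_mod_cast hr.ne'
  rw [abs_of_pos (inv_pos.2 hr), Complex.real_smul] at h
  have h3 : ∀ I : ℂ, I = r * ((r⁻¹ : ℝ) * I) := fun I => by push_cast; field_simp
  rw [h3 (∫ τ : ℝ, _), ← h, ← mul_assoc, mul_comm (1 / (2 * (π : ℂ)))]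
  congr 1
  refine integral_congr_ae (Filter.Eventually.of_forall fun t => ?_)
  have e : (((r * σ : ℝ) : ℂ) + ((r * t : ℝ) : ℂ) * Complex.I) = r * ((σ : ℂ) + t * Complex.I) := by
    push_cast; ring
  simp only [e]
  rw [mul_comm]
  congr 1
  rw [pos_cpow (rpow_pos_of_pos hw _), pos_cpow hw, Real.log_rpow hw]
  push_cast
  congr 1
  field_simp

lemma fubini_integrable {r a Z v σ : ℝ} (hr : 0 < r) (ha : 0 < a) (hZ : 0 < Z) (hσ : 0 < σ)
    (hσv : -(v + 1) < σ) :
    Integrable (Function.uncurry fun (y t : ℝ) => ((Real.exp (-a * y) * y ^ v : ℝ) : ℂ) *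
      (Complex.Gamma (r * ((σ : ℂ) + t * Complex.I)) *
        ((Z / y : ℝ) : ℂ) ^ (-((σ : ℂ) + t * Complex.I))))
      ((volume.restrict (Set.Ioi (0:ℝ))).prod volume) := by
  have hA : Integrable (fun y : ℝ => ((y ^ (v + σ) * Real.exp (-a * y) : ℝ) : ℂ))
      (volume.restrict (Set.Ioi (0:ℝ))) := by
    have := integrableOn_rpow_mul_exp_neg_mul_rpow (p := 1) (s := v + σ) (b := a)
      (by linarith) one_pos ha
    simp only [Real.rpow_one] at this
    exact Integrable.ofReal this
  have hB : Integrable (fun t : ℝ => Complex.Gamma (r * ((σ : ℂ) + t * Complex.I)) *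
      ((Z ^ (-σ) : ℝ) : ℂ)) := by
    have := (gamma_vert (mul_pos hr hσ)).comp_mul_left' hr.ne'
    refine (this.congr (Filter.Eventually.of_forall fun t => ?_)).mul_const _
    simp only
    congr 1
    push_cast; ring
  have hm : Measurable fun q : ℝ × ℝ => ((Z / q.1 : ℝ) : ℂ) ^ (-((q.2 : ℂ) * Complex.I)) := by
    fun_prop
  have hpos : ∀ᵐ q : ℝ × ℝ ∂((volume.restrict (Set.Ioi (0:ℝ))).prod volume), 0 < q.1 := by
    have : ∀ᵐ y : ℝ ∂(volume.restrict (Set.Ioi (0:ℝ))), 0 < y :=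
      ae_restrict_mem measurableSet_Ioi
    exact Measure.quasiMeasurePreserving_fst.ae this
  have h := (hA.mul_prod hB).bdd_mul (c := 1) hm.aestronglyMeasurable (by
    filter_upwards [hpos] with q hq
    rw [norm_cpow_eq_rpow_re_of_pos (div_pos hZ hq)]
    simp)
  refine h.congr ?_
  filter_upwards [hpos] with q hq
  obtain ⟨y, t⟩ := q
  simp only at hq
  simp only [Function.uncurry]
  rw [Real.rpow_add hq, neg_add, Complex.cpow_add _ _ (by exact_mod_cast (div_pos hZ hq).ne'),
    ← Complex.ofReal_neg σ, ← Complex.ofReal_cpow (div_pos hZ hq).le,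
    Real.div_rpow hZ.le hq.le, Real.rpow_neg hq.le, div_inv_eq_mul]
  push_cast
  ring

lemma inner_integral {a Z v σ : ℝ} (ha : 0 < a) (hZ : 0 < Z)
    (hσv : -(v + 1) < σ) (G : ℂ) (t : ℝ) :
    ∫ y in Set.Ioi (0:ℝ), ((Real.exp (-a * y) * y ^ v : ℝ) : ℂ) *
      (G * ((Z / y : ℝ) : ℂ) ^ (-((σ : ℂ) + t * Complex.I))) =
    ((a ^ (-(v + 1)) : ℝ) : ℂ) * (G * Complex.Gamma ((v : ℂ) + 1 + σ + t * Complex.I) *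
      ((a * Z : ℝ) : ℂ) ^ (-((σ : ℂ) + t * Complex.I))) := by
  have h := integral_cpow_mul_exp_neg_mul_Ioi (a := (v : ℂ) + 1 + σ + t * Complex.I) (r := a)
    (by simp; linarith) ha
  have e : ∀ y ∈ Set.Ioi (0:ℝ), ((Real.exp (-a * y) * y ^ v : ℝ) : ℂ) *
      (G * ((Z / y : ℝ) : ℂ) ^ (-((σ : ℂ) + t * Complex.I))) =
      (G * (Z : ℂ) ^ (-((σ : ℂ) + t * Complex.I))) *
      ((y : ℂ) ^ ((v : ℂ) + 1 + σ + t * Complex.I - 1) * Complex.exp (-((a : ℂ) * y))) := by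
    intro y hy
    have hy : 0 < y := hy
    rw [Complex.ofReal_mul, Complex.ofReal_cpow hy.le, pos_cpow hy, pos_cpow hy,
      pos_cpow hZ, pos_cpow (div_pos hZ hy), Real.log_div hZ.ne' hy.ne']
    have e1 : Complex.exp (((Real.log Z - Real.log y : ℝ) : ℂ) * -((σ : ℂ) + t * Complex.I)) =
        Complex.exp ((Real.log Z : ℂ) * -((σ : ℂ) + t * Complex.I)) *
        Complex.exp ((Real.log y : ℂ) * ((σ : ℂ) + t * Complex.I)) := by
      rw [← Complex.exp_add]; congr 1; push_cast; ring
    have e2 : Complex.exp ((Real.log y : ℂ) * ((v : ℂ) + 1 + σ + t * Complex.I - 1)) =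
        Complex.exp ((Real.log y : ℂ) * v) *
        Complex.exp ((Real.log y : ℂ) * ((σ : ℂ) + t * Complex.I)) := by
      rw [← Complex.exp_add]; congr 1; ring
    rw [e1, e2]
    push_cast
    rw [neg_mul]
    ring
  rw [setIntegral_congr_fun measurableSet_Ioi e, integral_const_mul, h,
    one_div, ← Complex.ofReal_inv, pos_cpow (inv_pos.2 ha), Complex.ofReal_cpow ha.le,
    pos_cpow ha, pos_cpow hZ, pos_cpow (mul_pos ha hZ), Real.log_inv, Real.log_mul ha.ne' hZ.ne']
  have e3 : Complex.exp (((Real.log a + Real.log Z : ℝ) : ℂ) * -((σ : ℂ) + t * Complex.I)) =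
      Complex.exp ((Real.log Z : ℂ) * -((σ : ℂ) + t * Complex.I)) *
      Complex.exp ((Real.log a : ℂ) * -((σ : ℂ) + t * Complex.I)) := by
    rw [← Complex.exp_add]; congr 1; push_cast; ring
  have e4 : Complex.exp (((-Real.log a : ℝ) : ℂ) * ((v : ℂ) + 1 + σ + t * Complex.I)) =
      Complex.exp ((Real.log a : ℂ) * ((-(v + 1) : ℝ) : ℂ)) *
      Complex.exp ((Real.log a : ℂ) * -((σ : ℂ) + t * Complex.I)) := by
    rw [← Complex.exp_add]; congr 1; push_cast; ring
  rw [e3, e4]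
  ring

theorem screened_nonresonant_N1_mellin_barnes (m n : ℕ) (hm : 0 < m) (hn : 0 < n)
    (a z v : ℝ) (ha : 0 < a) (hz : 0 < z)
    (σ : ℝ) (hσ : 0 < σ) (hσv : -(v + 1) < σ) :
    ((∫ y in Set.Ioi (0:ℝ),
        Real.exp (-a * y) * y ^ v * Real.exp (-z * y ^ (-((n : ℝ) / m))) : ℝ) : ℂ) =
      ((a ^ (-(v + 1)) : ℝ) : ℂ) * ((m : ℂ) / n) * (1 / (2 * (π : ℂ))) *
        ∫ τ : ℝ,
          Complex.Gamma (((m : ℝ) / n) * ((σ : ℂ) + τ * Complex.I)) *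
            Complex.Gamma ((v : ℂ) + 1 + σ + τ * Complex.I) *
            (((a * z ^ ((m : ℝ) / n) : ℝ) : ℂ) ^ (-((σ : ℂ) + τ * Complex.I))) := by
  have hmr : (0:ℝ) < m := by exact_mod_cast hm
  have hnr : (0:ℝ) < n := by exact_mod_cast hn
  obtain ⟨r, hr⟩ : ∃ r : ℝ, r = (m : ℝ) / n := ⟨_, rfl⟩
  have hr0 : 0 < r := by rw [hr]; positivity
  have hp : (n : ℝ) / m = 1 / r := by rw [hr, one_div_div]
  have hrC : ((m : ℝ) : ℂ) / n = r := by rw [hr]; push_cast; rfl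
  have hrC' : (m : ℂ) / n = r := by rw [hr]; push_cast; rfl
  rw [hp, hrC', ← hr]
  simp only [hrC', Complex.ofReal_natCast]
  have hZ : 0 < z ^ r := rpow_pos_of_pos hz r
  generalize hZd : z ^ r = Z at *
  rw [← integral_complex_ofReal]
  have e : ∀ y ∈ Set.Ioi (0:ℝ),
      ((Real.exp (-a * y) * y ^ v * Real.exp (-z * y ^ (-(1 / r))) : ℝ) : ℂ) =
      (r * (1 / (2 * (π : ℂ)))) * ∫ t : ℝ, ((Real.exp (-a * y) * y ^ v : ℝ) : ℂ) *
      (Complex.Gamma (r * ((σ : ℂ) + t * Complex.I)) *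
        ((Z / y : ℝ) : ℂ) ^ (-((σ : ℂ) + t * Complex.I))) := by
    intro y hy
    have hy : 0 < y := hy
    have hx : -z * y ^ (-(1 / r)) = -((Z / y) ^ (1 / r)) := by
      rw [← hZd, Real.div_rpow (by positivity) hy.le, ← Real.rpow_mul hz.le,
        mul_one_div_cancel hr0.ne', Real.rpow_one, Real.rpow_neg hy.le, neg_mul, ← div_eq_mul_inv]
    rw [hx, Complex.ofReal_mul, exp_inv2 hr0 hσ (div_pos hZ hy), integral_const_mul]
    ring
  rw [setIntegral_congr_fun measurableSet_Ioi e, integral_const_mul,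
    integral_integral_swap (fubini_integrable hr0 ha hZ hσ hσv)]
  simp_rw [inner_integral ha hZ hσv]
  rw [integral_const_mul]
  ring
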